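/- arXiv:2007.02318 — 5 statements merged into one kernel-verified Lean document; each statement's English description precedes it below -/
import Mathlib

section
/- Let K be a number field of degree n = [K:ℚ] over ℚ whose ring of integers 𝓞_K is a principal ideal domain (equivalently, a unique factorization domain), and let d ≥ 2 be a natural number. Then d is an irreducible element of 𝓞_K if and only if φ_K(d) = d^n − 1. -/
open NumberField

/-- The generalized totient function `φ_K(d)`: the cardinality of the unit group of
`𝓞_K / d𝓞_K`. -/
noncomputable def phiK (K : Type*) [Field K] [NumberField K] (d : ℕ) : ℕ :=
  Nat.card ((𝓞 K ⧸ Ideal.span {(d : 𝓞 K)})ˣ)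

/-- A finite nontrivial commutative ring is a field if and only if it has exactly one non-unit. -/
theorem isField_iff_natCard_units (R : Type*) [CommRing R] [Nontrivial R] [Finite R] :
    IsField R ↔ Nat.card Rˣ = Nat.card R - 1 := by
  constructor
  · intro h
    let := h.toField
    exact Nat.card_units R
  · intro h
    let f : Rˣ → {x : R // x ≠ 0} := fun u ↦ ⟨u, u.ne_zero⟩
    have hf : f.Injective := fun u v huv ↦ Units.ext (congrArg Subtype.val huv)
    have hcard : Nat.card {x : R // x ≠ 0} = Nat.card R - 1 := by
      have := Set.ncard_compl ({0} : Set R)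
      rwa [Set.ncard_singleton] at this
    have hsurj := (hf.bijective_of_nat_card_le (by rw [hcard, h])).surjective
    refine ⟨exists_pair_ne R, mul_comm, fun {a} ha ↦ ?_⟩
    obtain ⟨u, hu⟩ := hsurj ⟨a, ha⟩
    obtain rfl : (u : R) = a := congrArg Subtype.val hu
    exact ⟨↑u⁻¹, u.mul_inv⟩

theorem stmt_2 (K : Type*) [Field K] [NumberField K]
    [IsPrincipalIdealRing (𝓞 K)] (d : ℕ) (hd : 2 ≤ d) :
    Irreducible (d : 𝓞 K) ↔ phiK K d = d ^ (Module.finrank ℚ K) - 1 := by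
  have hd0 : (d : 𝓞 K) ≠ 0 := Nat.cast_ne_zero.mpr (by lia)
  have hcard : Nat.card (𝓞 K ⧸ Ideal.span {(d : 𝓞 K)}) = d ^ Module.finrank ℚ K := by
    rw [← Submodule.cardQuot_apply, ← Ideal.absNorm_apply, Ideal.absNorm_span_natCast,
      RingOfIntegers.rank]
  have hone : 1 < Nat.card (𝓞 K ⧸ Ideal.span {(d : 𝓞 K)}) :=
    hcard ▸ Nat.one_lt_pow Module.finrank_pos.ne' hd
  have : Finite (𝓞 K ⧸ Ideal.span {(d : 𝓞 K)}) := Nat.finite_of_card_ne_zero (by lia)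
  have : Nontrivial (𝓞 K ⧸ Ideal.span {(d : 𝓞 K)}) :=
    Finite.one_lt_card_iff_nontrivial.mp hone
  rw [Ideal.irreducible_iff_isMaximal_span_singleton hd0,
    Ideal.submodule_span_eq, Ideal.Quotient.maximal_ideal_iff_isField_quotient,
    isField_iff_natCard_units, hcard, phiK]
end

section
/- Let K be a number field of degree n = [K:ℚ] ≥ 2 whose ring of integers 𝓞_K is a principal ideal domain (equivalently, a unique factorization domain), and let d ≥ 2 be a squarefree natural number that is realizable over K. Then d is a Lehmer number over K; that is, φ_K(d) divides d^n − 1 if and only if d is an irreducible element of 𝓞_K. -/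
open NumberField

/-- A natural number `d` is realizable over `K` if every prime number dividing `d`
in `ℤ` is an irreducible element of `𝓞_K`. -/
def Realizable (K : Type*) [Field K] [NumberField K] (d : ℕ) : Prop :=
  ∀ p : ℕ, p.Prime → p ∣ d → Irreducible (p : 𝓞 K)

/-- A telescoping lower bound: for a finite set of natural numbers `≥ 2`, the product of
`1 - 1 / p ^ 2` exceeds `1 / 2`. -/
theorem half_lt_prod_one_sub_inv_sq (S : Finset ℕ) (hS : ∀ p ∈ S, 2 ≤ p) :
    (1 / 2 : ℝ) < ∏ p ∈ S, (1 - 1 / (p : ℝ) ^ 2 : ℝ) := by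
  have telescope : ∀ m : ℕ, ∏ k ∈ Finset.Ico 2 (m + 2), (1 - 1 / (k : ℝ) ^ 2)
      = ((m : ℝ) + 2) / (2 * ((m : ℝ) + 1)) := by
    intro m
    induction m with
    | zero => norm_num
    | succ m ih =>
      rw [show m + 1 + 2 = (m + 2) + 1 by ring, Finset.prod_Ico_succ_top (by omega), ih]
      push_cast
      have h1 : (m : ℝ) + 1 ≠ 0 := by positivity
      have h2 : (m : ℝ) + 2 ≠ 0 := by positivity
      have h3 : (m : ℝ) + 1 + 1 ≠ 0 := by positivity
      field_simp
      ring
  have hsub : S ⊆ Finset.Ico 2 (S.sup id + 2) := fun p hp => by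
    have : p ≤ S.sup id := Finset.le_sup (f := id) hp
    have := hS p hp
    simp only [Finset.mem_Ico]
    omega
  have hle : ∏ k ∈ Finset.Ico 2 (S.sup id + 2), (1 - 1 / (k : ℝ) ^ 2)
      ≤ ∏ p ∈ S, (1 - 1 / (p : ℝ) ^ 2) := by
    refine Finset.prod_le_prod_of_subset_of_le_one hsub (fun k hk => ?_) (fun k _ _ => ?_)
    · have hk2 : (1 : ℝ) ≤ k := by
        have := (Finset.mem_Ico.mp hk).1
        exact_mod_cast (by omega : 1 ≤ k)
      rw [sub_nonneg, div_le_one (by positivity)]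
      exact one_le_pow₀ hk2
    · have : (0 : ℝ) ≤ 1 / (k : ℝ) ^ 2 := by positivity
      linarith
  refine lt_of_lt_of_le ?_ hle
  rw [telescope, div_lt_div_iff₀ (by norm_num) (by positivity)]
  linarith

theorem prod_pow_lt_two_mul_prod_pow_sub_one (S : Finset ℕ) (hS : ∀ p ∈ S, 2 ≤ p) {n : ℕ}
    (hn : 2 ≤ n) : ∏ p ∈ S, p ^ n < 2 * ∏ p ∈ S, (p ^ n - 1) := by
  have hcast : ((∏ p ∈ S, (p ^ n - 1) : ℕ) : ℝ)
      = (∏ p ∈ S, (p : ℝ) ^ n) * ∏ p ∈ S, (1 - 1 / (p : ℝ) ^ n) := by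
    rw [Nat.cast_prod, ← Finset.prod_mul_distrib]
    refine Finset.prod_congr rfl fun p hp => ?_
    have hp0 : 0 < p := by have := hS p hp; omega
    have hpR : (p : ℝ) ≠ 0 := by positivity
    rw [Nat.cast_sub (Nat.one_le_pow _ _ hp0)]
    push_cast
    field_simp
  have hmono : ∏ p ∈ S, (1 - 1 / (p : ℝ) ^ 2) ≤ ∏ p ∈ S, (1 - 1 / (p : ℝ) ^ n) := by
    have hone : ∀ p ∈ S, (1 : ℝ) ≤ p := fun p hp => by
      have := hS p hp
      exact_mod_cast (by omega : 1 ≤ p)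
    refine Finset.prod_le_prod (fun p hp => ?_) (fun p hp => ?_)
    · have := hone p hp
      rw [sub_nonneg, div_le_one (by positivity)]
      exact one_le_pow₀ this
    · have := hone p hp
      gcongr
  have hhalf := (half_lt_prod_one_sub_inv_sq S hS).trans_le hmono
  have hpos : 0 < ∏ p ∈ S, (p : ℝ) ^ n := Finset.prod_pos fun p hp => by
    have : 0 < p := by have := hS p hp; omega
    positivity
  have : (∏ p ∈ S, (p : ℝ) ^ n) < 2 * ((∏ p ∈ S, (p ^ n - 1) : ℕ) : ℝ) := by
    rw [hcast]
    nlinarith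
  exact_mod_cast this

theorem prod_pow_sub_one_not_dvd (S : Finset ℕ) (hS : ∀ p ∈ S, 2 ≤ p) (hcard : 2 ≤ S.card)
    {n : ℕ} (hn : 2 ≤ n) : ¬ ∏ p ∈ S, (p ^ n - 1) ∣ ∏ p ∈ S, p ^ n - 1 := by
  rintro ⟨k, hk⟩
  have hlt := prod_pow_lt_two_mul_prod_pow_sub_one S hS hn
  have hpow : ∀ p ∈ S, 2 ≤ p ^ n := fun p hp => (hS p hp).trans (Nat.le_self_pow (by omega) p)
  obtain ⟨p, hp⟩ : S.Nonempty := Finset.card_pos.mp (by omega)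
  have hsplit := Finset.mul_prod_erase S (fun p => p ^ n) hp
  have hsplit' := Finset.mul_prod_erase S (fun p => p ^ n - 1) hp
  have hle : ∏ q ∈ S.erase p, (q ^ n - 1) ≤ ∏ q ∈ S.erase p, q ^ n :=
    Finset.prod_le_prod' fun q _ => Nat.sub_le _ _
  obtain ⟨q, hq⟩ : (S.erase p).Nonempty :=
    Finset.card_pos.mp (by rw [Finset.card_erase_of_mem hp]; omega)
  have hbig : 2 ≤ ∏ q ∈ S.erase p, q ^ n :=
    (hpow q (Finset.mem_of_mem_erase hq)).trans <| Nat.le_of_dvd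
      (Finset.prod_pos fun r hr => by have := hpow r (Finset.mem_of_mem_erase hr); omega)
      (Finset.dvd_prod_of_mem (fun p => p ^ n) hq)
  obtain ⟨a, ha⟩ : ∃ a, p ^ n = a + 1 := ⟨p ^ n - 1, by have := hpow p hp; omega⟩
  simp only [ha, Nat.add_sub_cancel] at hsplit hsplit'
  set A := ∏ p ∈ S, (p ^ n - 1)
  set D := ∏ p ∈ S, p ^ n
  have hAD : A + 1 < D := by nlinarith
  have hk2 : k < 2 := by
    by_contra! h
    have : A * 2 ≤ A * k := Nat.mul_le_mul_left _ h
    omega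
  interval_cases k <;> omega

section Totient

variable (K : Type*) [Field K] [NumberField K]

theorem phiK_one : phiK K 1 = 1 := by
  unfold phiK
  have : Subsingleton (𝓞 K ⧸ Ideal.span {((1 : ℕ) : 𝓞 K)}) :=
    Ideal.Quotient.subsingleton_iff.mpr (by simp)
  exact Nat.card_unique

theorem phiK_mul_of_coprime {a b : ℕ} (hab : a.Coprime b) :
    phiK K (a * b) = phiK K a * phiK K b := by
  unfold phiK
  have hcop : IsCoprime (Ideal.span {(a : 𝓞 K)}) (Ideal.span {(b : 𝓞 K)}) := by
    rw [Ideal.isCoprime_span_singleton_iff]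
    simpa using (Nat.isCoprime_iff_coprime.mpr hab).map (Int.castRingHom (𝓞 K))
  rw [Nat.cast_mul, ← Ideal.span_singleton_mul_span_singleton,
    Nat.card_congr (Units.mapEquiv
      (Ideal.quotientMulEquivQuotientProd _ _ hcop).toMulEquiv).toEquiv,
    Nat.card_congr MulEquiv.prodUnits.toEquiv, Nat.card_prod]

theorem card_quotient_span_natCast (d : ℕ) :
    Nat.card (𝓞 K ⧸ Ideal.span {(d : 𝓞 K)}) = d ^ Module.finrank ℚ K := by
  have h := Ideal.absNorm_span_singleton (d : 𝓞 K)
  have h2 : Algebra.norm ℤ ((d : ℕ) : 𝓞 K) = (d : ℤ) ^ Module.finrank ℤ (𝓞 K) := by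
    simpa using Algebra.norm_algebraMap (S := 𝓞 K) (d : ℤ)
  rw [h2, RingOfIntegers.rank, Int.natAbs_pow, Int.natAbs_natCast] at h
  rw [← h, Ideal.absNorm_apply, Submodule.cardQuot_apply]

theorem phiK_of_irreducible [IsPrincipalIdealRing (𝓞 K)] {p : ℕ}
    (hp : Irreducible (p : 𝓞 K)) : phiK K p = p ^ Module.finrank ℚ K - 1 := by
  have := PrincipalIdealRing.isMaximal_of_irreducible hp
  let _ := Ideal.Quotient.field (Ideal.span {(p : 𝓞 K)})
  rw [← card_quotient_span_natCast K p]
  exact Nat.card_units _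

theorem phiK_prod_primes [IsPrincipalIdealRing (𝓞 K)] (S : Finset ℕ)
    (hprime : ∀ p ∈ S, p.Prime) (hirr : ∀ p ∈ S, Irreducible (p : 𝓞 K)) :
    phiK K (∏ p ∈ S, p) = ∏ p ∈ S, (p ^ Module.finrank ℚ K - 1) := by
  induction S using Finset.induction_on with
  | empty => simpa using phiK_one K
  | insert p S hpS ih =>
    rw [Finset.prod_insert hpS, Finset.prod_insert hpS, phiK_mul_of_coprime,
      phiK_of_irreducible K (hirr p (Finset.mem_insert_self p S)),
      ih (fun q hq => hprime q (Finset.mem_insert_of_mem hq))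
        (fun q hq => hirr q (Finset.mem_insert_of_mem hq))]
    refine Nat.Coprime.prod_right fun q hq => ?_
    rw [Nat.coprime_primes (hprime p (Finset.mem_insert_self p S))
      (hprime q (Finset.mem_insert_of_mem hq))]
    rintro rfl
    exact hpS hq

variable {K} in
theorem Realizable.irreducible_iff_prime {d : ℕ} (hreal : Realizable K d) (hd : 2 ≤ d) :
    Irreducible (d : 𝓞 K) ↔ d.Prime := by
  refine ⟨fun h => ?_, fun h => hreal d h dvd_rfl⟩
  obtain ⟨p, hp, m, rfl⟩ := Nat.exists_prime_and_dvd (show d ≠ 1 by omega)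
  rw [Nat.cast_mul] at h
  have hm : IsUnit (m : 𝓞 K) :=
    (h.isUnit_or_isUnit rfl).resolve_left (hreal p hp (dvd_mul_right p m)).not_isUnit
  have hm1 : m = 1 := by
    by_contra hne
    obtain ⟨q, hq, hqm⟩ := Nat.exists_prime_and_dvd hne
    exact (hreal q hq (hqm.mul_left p)).not_isUnit
      (isUnit_of_dvd_unit (Nat.cast_dvd_cast hqm) hm)
  simpa [hm1] using hp

end Totient

theorem stmt_8 (K : Type*) [Field K] [NumberField K]
    [IsPrincipalIdealRing (𝓞 K)] (hn : 2 ≤ Module.finrank ℚ K)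
    (d : ℕ) (hd2 : 2 ≤ d) (hd : Squarefree d) (hreal : Realizable K d) :
    phiK K d ∣ d ^ (Module.finrank ℚ K) - 1 ↔ Irreducible (d : 𝓞 K) := by
  refine ⟨fun h => ?_, fun h => by rw [phiK_of_irreducible K h]⟩
  have hprod := Nat.prod_primeFactors_of_squarefree hd
  have hprime : ∀ p ∈ d.primeFactors, p.Prime := fun p hp => Nat.prime_of_mem_primeFactors hp
  rw [hreal.irreducible_iff_prime hd2]
  by_contra hnp
  have hcard : 2 ≤ d.primeFactors.card := by
    by_contra! hlt
    obtain ⟨p, hp⟩ := Nat.nonempty_primeFactors.mpr hd2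
    have hS : d.primeFactors = {p} :=
      Finset.eq_singleton_iff_unique_mem.mpr
        ⟨hp, fun q hq => Finset.card_le_one.mp (by omega) q hq p hp⟩
    rw [hS, Finset.prod_singleton] at hprod
    exact hnp (hprod ▸ hprime p hp)
  refine prod_pow_sub_one_not_dvd d.primeFactors (fun p hp => (hprime p hp).two_le) hcard hn ?_
  rwa [Finset.prod_pow, hprod, ← phiK_prod_primes K d.primeFactors hprime
    (fun p hp => hreal p (hprime p hp) (Nat.dvd_of_mem_primeFactors hp)), hprod]
end

section
/- Let K be a number field of degree n = [K:ℚ] whose ring of integers 𝓞_K is a principal ideal domain (equivalently, a unique factorization domain), and let d ≥ 2 be a natural number that is both a Lehmer number over K and normal over K. If φ(d) divides d − 1 (where φ is Euler's totient function), then d is a prime number. -/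
open NumberField

/-- `d` is a Lehmer number over `K`: `φ_K(d) ∣ d^n - 1` iff `d` is irreducible in `𝓞_K`,
where `n = [K:ℚ]`. -/
def IsLehmer (K : Type*) [Field K] [NumberField K] (d : ℕ) : Prop :=
  phiK K d ∣ d ^ (Module.finrank ℚ K) - 1 ↔ Irreducible (d : 𝓞 K)

/-- `d` is normal over `K`: `φ_K(d)/φ(d)` divides `(d^n - 1)/(d - 1)`,
where `n = [K:ℚ]`. -/
def IsNormalNum (K : Type*) [Field K] [NumberField K] (d : ℕ) : Prop :=
  phiK K d / Nat.totient d ∣ (d ^ (Module.finrank ℚ K) - 1) / (d - 1)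

/-- Divisibility of natural numbers can be tested in the ring of integers of a number field. -/
theorem NumberField.RingOfIntegers.natCast_dvd_natCast (K : Type*) [Field K] [NumberField K]
    {a b : ℕ} : (a : 𝓞 K) ∣ (b : 𝓞 K) ↔ a ∣ b := by
  refine ⟨fun h => ?_, fun h => Nat.cast_dvd_cast h⟩
  have hb : (b : ℤ) ∈ ((Ideal.span {(a : ℤ)}).map (algebraMap ℤ (𝓞 K))).comap
      (algebraMap ℤ (𝓞 K)) := by
    rw [Ideal.mem_comap, Ideal.map_span, Set.image_singleton, Ideal.mem_span_singleton]
    simpa using h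
  rw [Ideal.comap_map_eq_self_of_faithfullyFlat, Ideal.mem_span_singleton] at hb
  exact_mod_cast hb

/-- Euler's totient divides the generalized totient. -/
theorem totient_dvd_phiK (K : Type*) [Field K] [NumberField K] {d : ℕ} (hd : d ≠ 0) :
    Nat.totient d ∣ phiK K d := by
  have : NeZero d := ⟨hd⟩
  have : CharP (𝓞 K ⧸ Ideal.span {(d : 𝓞 K)}) d := ⟨fun x => by
    rw [← map_natCast (Ideal.Quotient.mk (Ideal.span {(d : 𝓞 K)})),
      Ideal.Quotient.eq_zero_iff_mem, Ideal.mem_span_singleton,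
      NumberField.RingOfIntegers.natCast_dvd_natCast]⟩
  let f : ZMod d →* 𝓞 K ⧸ Ideal.span {(d : 𝓞 K)} := (ZMod.castHom dvd_rfl _).toMonoidHom
  have hf : Function.Injective f := ZMod.castHom_injective _
  have h := Subgroup.card_dvd_of_injective _ (Units.map_injective hf)
  rwa [Nat.card_eq_fintype_card, ZMod.card_units_eq_totient] at h

/-- A natural number that is irreducible in the ring of integers of a number field is prime. -/
theorem Nat.prime_of_irreducible_ringOfIntegers (K : Type*) [Field K] [NumberField K] {d : ℕ}
    (h : Irreducible (d : 𝓞 K)) : d.Prime := by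
  have hunit {a : ℕ} : IsUnit (a : 𝓞 K) ↔ IsUnit a := by
    rw [isUnit_iff_dvd_one, isUnit_iff_dvd_one, ← Nat.cast_one,
      NumberField.RingOfIntegers.natCast_dvd_natCast]
  refine ⟨fun hd => h.not_isUnit (hunit.2 hd), fun a b hab => ?_⟩
  rw [← hunit, ← hunit]
  exact h.isUnit_or_isUnit (by rw [hab, Nat.cast_mul])

theorem stmt_10 (K : Type*) [Field K] [NumberField K]
    [IsPrincipalIdealRing (𝓞 K)] (d : ℕ) (hd : 2 ≤ d)
    (hLehmer : IsLehmer K d) (hNormal : IsNormalNum K d)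
    (hphi : Nat.totient d ∣ d - 1) : d.Prime := by
  refine Nat.prime_of_irreducible_ringOfIntegers K (hLehmer.1 ?_)
  have h := mul_dvd_mul hphi hNormal
  rwa [Nat.mul_div_cancel' (totient_dvd_phiK K (by omega)),
    Nat.mul_div_cancel' (by simpa using Nat.sub_dvd_pow_sub_pow d 1 _)] at h
end

section
/- Let K be a number field of degree n = [K:ℚ] whose ring of integers 𝓞_K is a principal ideal domain (equivalently, a unique factorization domain), and let p be a prime number in ℤ. Then p is normal over K if and only if φ_K(p) divides p^n − 1. -/
open NumberField

/-- A rational prime is not a unit in the ring of integers of a number field. -/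
lemma not_isUnit_natCast_ringOfIntegers (K : Type*) [Field K] [NumberField K] {p : ℕ}
    (hp : p.Prime) : ¬ IsUnit (p : 𝓞 K) := by
  intro h
  have h' : IsUnit (algebraMap ℤ (𝓞 K) (p : ℤ)) := by simpa using h
  exact (Nat.prime_iff_prime_int.mp hp).not_isUnit (isUnit_of_map_unit _ _ h')

/-- `φ(p) = p - 1` divides `φ_K(p)`, since `(ℤ/p)ˣ` embeds in `(𝓞_K / p𝓞_K)ˣ`. -/
lemma sub_one_dvd_phiK (K : Type*) [Field K] [NumberField K] {p : ℕ} (hp : p.Prime) :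
    p - 1 ∣ phiK K p := by
  have : Fact p.Prime := ⟨hp⟩
  have hnu := not_isUnit_natCast_ringOfIntegers K hp
  have : CharP (𝓞 K ⧸ Ideal.span {(p : 𝓞 K)}) p := CharP.quotient (𝓞 K) p hnu
  have hinj := Units.map_injective
    (f := (ZMod.castHom dvd_rfl (𝓞 K ⧸ Ideal.span {(p : 𝓞 K)})).toMonoidHom)
    (ZMod.castHom_injective _)
  have h := Subgroup.card_dvd_of_injective _ hinj
  rwa [Nat.card_eq_fintype_card, ZMod.card_units] at h

theorem stmt_11 (K : Type*) [Field K] [NumberField K]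
    [IsPrincipalIdealRing (𝓞 K)] (p : ℕ) (hp : p.Prime) :
    IsNormalNum K p ↔ phiK K p ∣ p ^ (Module.finrank ℚ K) - 1 := by
  obtain ⟨m, hm⟩ := sub_one_dvd_phiK K hp
  obtain ⟨s, hs⟩ := Nat.sub_one_dvd_pow_sub_one p (Module.finrank ℚ K)
  have hpos : 0 < p - 1 := Nat.sub_pos_of_lt hp.one_lt
  rw [IsNormalNum, Nat.totient_prime hp, hm, hs, Nat.mul_div_cancel_left _ hpos,
    Nat.mul_div_cancel_left _ hpos, Nat.mul_dvd_mul_iff_left hpos]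
end

section
/- Let w be a squarefree natural number and let l ∈ ℚ satisfy l < w/φ(w). Then the set of squarefree natural numbers d such that w divides d and (d − 1)/φ(d) = l is finite. -/
theorem totient_mul_le_mul_totient_of_dvd_of_squarefree {w d : ℕ} (hd : Squarefree d)
    (h : w ∣ d) : Nat.totient d * w ≤ d * Nat.totient w := by
  obtain ⟨k, rfl⟩ := h
  rw [Nat.totient_mul (Nat.coprime_of_squarefree_mul hd)]
  calc w.totient * k.totient * w ≤ w.totient * k * w := by gcongr; exact Nat.totient_le k
    _ = w * k * w.totient := by ring

theorem stmt_17 (w : ℕ) (hw : Squarefree w) (l : ℚ)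
    (hl : l < (w : ℚ) / (Nat.totient w : ℚ)) :
    {d : ℕ | Squarefree d ∧ w ∣ d ∧ ((d : ℚ) - 1) / (Nat.totient d : ℚ) = l}.Finite := by
  have hφw : (0 : ℚ) < Nat.totient w := by
    exact_mod_cast Nat.totient_pos.mpr (Nat.pos_of_ne_zero hw.ne_zero)
  have hc : 0 < (w : ℚ) - l * Nat.totient w := sub_pos.mpr ((lt_div_iff₀ hφw).mp hl)
  refine (Set.finite_Iic
    ⌊|l| * (Nat.totient w / ((w : ℚ) - l * Nat.totient w)) + 1⌋₊).subset ?_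
  rintro d ⟨hd, hwd, h⟩
  have hφd : (0 : ℚ) < Nat.totient d := by
    exact_mod_cast Nat.totient_pos.mpr (Nat.pos_of_ne_zero hd.ne_zero)
  have hdl : (d : ℚ) - 1 = l * Nat.totient d := (div_eq_iff hφd.ne').mp h
  have hle : (Nat.totient d : ℚ) * w ≤ d * Nat.totient w := by
    exact_mod_cast totient_mul_le_mul_totient_of_dvd_of_squarefree hd hwd
  rw [sub_eq_iff_eq_add.mp hdl] at hle
  have hbound : (Nat.totient d : ℚ) ≤ Nat.totient w / ((w : ℚ) - l * Nat.totient w) := by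
    rw [le_div_iff₀ hc]
    linarith
  refine Nat.le_floor ?_
  calc (d : ℚ) = l * Nat.totient d + 1 := sub_eq_iff_eq_add.mp hdl
    _ ≤ |l| * Nat.totient d + 1 := by gcongr; exact le_abs_self l
    _ ≤ _ := by gcongr
end
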